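/- Let A be a split regular BiHom-Poisson superalgebra with root system Λ, and let [α], [β] ∈ Λ/∼ with [α] ≠ [β]. Then [I_{[α]}, I_{[β]}] + I_{[α]}·I_{[β]} = 0. -/

import Mathlib

/-- A (regular, with distinguished maximal abelian graded subalgebra `H`)
BiHom-Poisson superalgebra over a field `K`. -/
structure BHPS (K A : Type*) [Field K] [AddCommGroup A] [Module K A] where
  /-- the ℤ₂-grading -/
  grade : ZMod 2 → Submodule K A
  gradeInternal : DirectSum.IsInternal grade
  /-- the bracket -/
  br : A →ₗ[K] A →ₗ[K] A
  /-- the associative-type product -/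
  mu : A →ₗ[K] A →ₗ[K] A
  /-- the first structure map -/
  phi : A ≃ₗ[K] A
  /-- the second structure map -/
  psi : A ≃ₗ[K] A
  br_grade : ∀ (i j : ZMod 2), ∀ x ∈ grade i, ∀ y ∈ grade j, br x y ∈ grade (i + j)
  mu_grade : ∀ (i j : ZMod 2), ∀ x ∈ grade i, ∀ y ∈ grade j, mu x y ∈ grade (i + j)
  phi_grade : ∀ i, (grade i).map (phi : A →ₗ[K] A) = grade i
  psi_grade : ∀ i, (grade i).map (psi : A →ₗ[K] A) = grade i
  phi_psi_comm : ∀ x, phi (psi x) = psi (phi x)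
  phi_br : ∀ x y, phi (br x y) = br (phi x) (phi y)
  psi_br : ∀ x y, psi (br x y) = br (psi x) (psi y)
  phi_mu : ∀ x y, phi (mu x y) = mu (phi x) (phi y)
  psi_mu : ∀ x y, psi (mu x y) = mu (psi x) (psi y)
  skew : ∀ (i j : ZMod 2), ∀ x ∈ grade i, ∀ y ∈ grade j,
    br (psi x) (phi y) = -((-1 : K) ^ (i.val * j.val)) • br (psi y) (phi x)
  jacobi : ∀ (i j k : ZMod 2), ∀ x ∈ grade i, ∀ y ∈ grade j, ∀ z ∈ grade k,
    ((-1 : K) ^ (i.val * k.val)) • br (psi (psi x)) (br (psi y) (phi z))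
      + ((-1 : K) ^ (i.val * j.val)) • br (psi (psi y)) (br (psi z) (phi x))
      + ((-1 : K) ^ (j.val * k.val)) • br (psi (psi z)) (br (psi x) (phi y)) = 0
  assoc : ∀ x y z, mu (phi x) (mu y z) = mu (mu x y) (psi z)
  leibniz : ∀ (j k : ZMod 2), ∀ (x : A), ∀ y ∈ grade j, ∀ z ∈ grade k,
    br (mu x y) (phi (psi z))
      = mu (phi x) (br y (phi z)) + ((-1 : K) ^ (j.val * k.val)) • mu (br x (psi z)) (phi y)
  /-- the maximal abelian graded subalgebra -/
  H : Submodule K A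
  H_graded : H = (H ⊓ grade 0) ⊔ (H ⊓ grade 1)
  H_abelian : ∀ x ∈ H, ∀ y ∈ H, br x y = 0
  phi_H : H.map (phi : A →ₗ[K] A) = H
  psi_H : H.map (psi : A →ₗ[K] A) = H
  H_max : ∀ H' : Submodule K A, H ≤ H' →
    H' = (H' ⊓ grade 0) ⊔ (H' ⊓ grade 1) →
    (∀ x ∈ H', ∀ y ∈ H', br x y = 0) →
    H'.map (phi : A →ₗ[K] A) = H' → H'.map (psi : A →ₗ[K] A) = H' → H' = H

namespace BHPS

variable {K A : Type*} [Field K] [AddCommGroup A] [Module K A] (D : BHPS K A)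

/-- The even part `H₀` of `H`. -/
def H0 : Submodule K A := D.H ⊓ D.grade 0

lemma phi_H0 : D.H0.map (D.phi : A →ₗ[K] A) = D.H0 := by
  unfold H0
  rw [Submodule.map_inf (D.phi : A →ₗ[K] A) D.phi.injective, D.phi_H, D.phi_grade]

lemma psi_H0 : D.H0.map (D.psi : A →ₗ[K] A) = D.H0 := by
  unfold H0
  rw [Submodule.map_inf (D.psi : A →ₗ[K] A) D.psi.injective, D.psi_H, D.psi_grade]

/-- The restriction of `φ` to `H₀`, as a linear automorphism. -/
def phiH0 : ↥D.H0 ≃ₗ[K] ↥D.H0 :=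
  (D.phi.submoduleMap D.H0).trans (LinearEquiv.ofEq _ _ D.phi_H0)

/-- The restriction of `ψ` to `H₀`, as a linear automorphism. -/
def psiH0 : ↥D.H0 ≃ₗ[K] ↥D.H0 :=
  (D.psi.submoduleMap D.H0).trans (LinearEquiv.ofEq _ _ D.psi_H0)

/-- The root space attached to a linear functional `α : H₀ → K`:
`A_α = {v : [h, φ(v)] = α(h) • φψ(v) for all h ∈ H₀}`. -/
def rootSpace (α : Module.Dual K ↥D.H0) : Submodule K A where
  carrier := {v | ∀ h : ↥D.H0, D.br (h : A) (D.phi v) = α h • D.phi (D.psi v)}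
  add_mem' := by
    intro a b ha hb h
    simp only [map_add, ha h, hb h, smul_add]
  zero_mem' := by
    intro h
    simp
  smul_mem' := by
    intro c v hv h
    simp only [map_smul, hv h]
    rw [smul_comm]

/-- The root system `Λ`. -/
def roots : Set (Module.Dual K ↥D.H0) := {α | α ≠ 0 ∧ D.rootSpace α ≠ ⊥}

/-- `A` is split with respect to `H`: `A = H ⊕ (⊕_{α ∈ Λ} A_α)`. -/
def IsSplit : Prop :=
  letI := Classical.decEq (Option ↥D.roots)
  DirectSum.IsInternal (fun o : Option ↥D.roots => o.elim D.H fun α => D.rootSpace α.1)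

/-- `α ∘ φ^{z₁} ∘ ψ^{z₂}`. -/
def twist (z₁ z₂ : ℤ) (γ : Module.Dual K ↥D.H0) : Module.Dual K ↥D.H0 :=
  γ ∘ₗ ((((D.phiH0 ^ z₁) : ↥D.H0 ≃ₗ[K] ↥D.H0) : ↥D.H0 →ₗ[K] ↥D.H0) ∘ₗ
        (((D.psiH0 ^ z₂) : ↥D.H0 ≃ₗ[K] ↥D.H0) : ↥D.H0 →ₗ[K] ↥D.H0))

/-- `±S = S ∪ (-S)`. -/
def pm (S : Set (Module.Dual K ↥D.H0)) : Set (Module.Dual K ↥D.H0) :=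
  S ∪ (Neg.neg '' S)

/-- The partial sums `α₁∘φ^{-i} + α₂∘φ^{-i+1}∘ψ^{-1} + ⋯ + α_i∘φ^{-1}∘ψ^{-1} + α_{i+1}∘ψ^{-1}`
appearing in the definition of a connection. -/
def chainSum (a : ℕ → Module.Dual K ↥D.H0) (i : ℕ) : Module.Dual K ↥D.H0 :=
  D.twist (-(i : ℤ)) 0 (a 1)
    + ∑ t ∈ Finset.Icc 2 (i + 1), D.twist (-((i : ℤ) + 1 - (t : ℤ))) (-1) (a t)

/-- `a 1, …, a k` is a connection from `α` to `β` (relative to the set of roots `S`). -/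
def IsConnectionIn (S : Set (Module.Dual K ↥D.H0)) (α β : Module.Dual K ↥D.H0)
    (k : ℕ) (a : ℕ → Module.Dual K ↥D.H0) : Prop :=
  2 ≤ k ∧
  (∀ t, 1 ≤ t → t ≤ k → a t ∈ D.pm S) ∧
  (∃ n r : ℕ, a 1 = D.twist (-(n : ℤ)) (-(r : ℤ)) α) ∧
  (∀ i, 1 ≤ i → i ≤ k - 2 → D.chainSum a i ∈ D.pm S) ∧
  (∃ m s : ℕ, D.chainSum a (k - 1) = D.twist (-(m : ℤ)) (-(s : ℤ)) β
      ∨ D.chainSum a (k - 1) = -(D.twist (-(m : ℤ)) (-(s : ℤ)) β))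

/-- `α` is connected to `β` (relative to the set of roots `S`). -/
def ConnectedIn (S : Set (Module.Dual K ↥D.H0)) (α β : Module.Dual K ↥D.H0) : Prop :=
  (∃ z₁ z₂ : ℤ, ∃ ε : K, (ε = 1 ∨ ε = -1) ∧ β = ε • D.twist z₁ z₂ α) ∨
  (∃ k a, D.IsConnectionIn S α β k a)

/-- `α` is connected to `β`. -/
def Connected (α β : Module.Dual K ↥D.H0) : Prop := D.ConnectedIn D.roots α β

/-- The set `[α]` of roots connected to `α`. -/
def classSet (α : Module.Dual K ↥D.H0) : Set (Module.Dual K ↥D.H0) :=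
  {β ∈ D.roots | D.Connected α β}

/-- `I_{H,[α]} = span {[A_{β∘ψ⁻¹}, A_{−β∘φ⁻¹}] + A_{β∘ψ⁻¹}·A_{−β∘φ⁻¹} : β ∈ [α]}`. -/
def IH (α : Module.Dual K ↥D.H0) : Submodule K A :=
  ⨆ β ∈ D.classSet α,
    (Submodule.map₂ D.br (D.rootSpace (D.twist 0 (-1) β)) (D.rootSpace (-(D.twist (-1) 0 β)))
      ⊔ Submodule.map₂ D.mu (D.rootSpace (D.twist 0 (-1) β)) (D.rootSpace (-(D.twist (-1) 0 β))))

/-- `V_{[α]} = ⊕_{β ∈ [α]} A_β`. -/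
def VS (α : Module.Dual K ↥D.H0) : Submodule K A :=
  ⨆ β ∈ D.classSet α, D.rootSpace β

/-- `I_{[α]} = I_{H,[α]} ⊕ V_{[α]}`. -/
def Iclass (α : Module.Dual K ↥D.H0) : Submodule K A := D.IH α ⊔ D.VS α

/-- `J` is an ideal of the (sub)algebra `I`. -/
def IsIdealIn (J I : Submodule K A) : Prop :=
  J ≤ I ∧ J = (J ⊓ D.grade 0) ⊔ (J ⊓ D.grade 1) ∧
  Submodule.map₂ D.br J I ≤ J ∧ Submodule.map₂ D.mu J I ≤ J ∧ Submodule.map₂ D.mu I J ≤ J ∧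
  J.map (D.phi : A →ₗ[K] A) = J ∧ J.map (D.psi : A →ₗ[K] A) = J

/-- `I` is an ideal of `A`: `[I,A] + I·A + A·I ⊆ I`, graded and `φ,ψ`-invariant. -/
def IsIdeal (I : Submodule K A) : Prop := D.IsIdealIn I ⊤

/-- `A` is simple: `[A,A] + A·A ≠ 0` and its only ideals are `0` and `A`. -/
def IsSimple : Prop :=
  (Submodule.map₂ D.br ⊤ ⊤ ⊔ Submodule.map₂ D.mu (⊤ : Submodule K A) ⊤ ≠ ⊥) ∧
  ∀ I : Submodule K A, D.IsIdeal I → I = ⊥ ∨ I = ⊤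

/-- The center `Z(A) = {v : [v,A] + v·A + A·v = 0}`. -/
def center : Submodule K A where
  carrier := {v | ∀ w, D.br v w = 0 ∧ D.mu v w = 0 ∧ D.mu w v = 0}
  add_mem' := by
    intro a b ha hb w
    obtain ⟨h1, h2, h3⟩ := ha w
    obtain ⟨g1, g2, g3⟩ := hb w
    simp [map_add, LinearMap.add_apply, h1, h2, h3, g1, g2, g3]
  zero_mem' := by intro w; simp
  smul_mem' := by
    intro c v hv w
    obtain ⟨h1, h2, h3⟩ := hv w
    simp [map_smul, LinearMap.smul_apply, h1, h2, h3]

/-- `Σ_{α∈Λ} ([A_{α∘ψ⁻¹}, A_{−α∘φ⁻¹}] + A_{α∘ψ⁻¹}·A_{−α∘φ⁻¹})`. -/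
def HSum : Submodule K A :=
  ⨆ α ∈ D.roots,
    (Submodule.map₂ D.br (D.rootSpace (D.twist 0 (-1) α)) (D.rootSpace (-(D.twist (-1) 0 α)))
      ⊔ Submodule.map₂ D.mu (D.rootSpace (D.twist 0 (-1) α)) (D.rootSpace (-(D.twist (-1) 0 α))))

/-- The root system is symmetric. -/
def IsSymmetric : Prop := ∀ α ∈ D.roots, -α ∈ D.roots

/-- `A` is root multiplicative. -/
def RootMultiplicative : Prop :=
  ∀ (i j : ZMod 2) (α β : Module.Dual K ↥D.H0), α ∈ D.roots → β ∈ D.roots →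
    D.rootSpace α ⊓ D.grade i ≠ ⊥ → D.rootSpace β ⊓ D.grade j ≠ ⊥ →
    (D.twist 0 (-1) α + D.twist (-1) 0 β) ∈ D.roots →
    D.rootSpace (D.twist 0 (-1) α + D.twist (-1) 0 β) ⊓ D.grade (i + j) ≠ ⊥ →
    Submodule.map₂ D.br (D.rootSpace α ⊓ D.grade i) (D.rootSpace β ⊓ D.grade j)
      ⊔ Submodule.map₂ D.mu (D.rootSpace α ⊓ D.grade i) (D.rootSpace β ⊓ D.grade j) ≠ ⊥

/-- `A` is of maximal length: every nonzero graded root space is one-dimensional. -/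
def MaximalLength : Prop :=
  ∀ (i : ZMod 2), ∀ α ∈ D.roots, D.rootSpace α ⊓ D.grade i ≠ ⊥ →
    Module.rank K ↥(D.rootSpace α ⊓ D.grade i) = 1

end BHPS

namespace BHPS

variable {K A : Type*} [Field K] [AddCommGroup A] [Module K A] (D : BHPS K A)

/-! ### Twists of linear functionals -/

lemma twist_apply (z w : ℤ) (γ : Module.Dual K ↥D.H0) (h : ↥D.H0) :
    D.twist z w γ h = γ ((D.phiH0 ^ z * D.psiH0 ^ w) h) := rfl

lemma coe_phiH0 (h : ↥D.H0) : ((D.phiH0 h : ↥D.H0) : A) = D.phi h := rfl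

lemma coe_psiH0 (h : ↥D.H0) : ((D.psiH0 h : ↥D.H0) : A) = D.psi h := rfl

lemma commute_phiH0_psiH0 : Commute D.phiH0 D.psiH0 := by
  ext h
  exact D.phi_psi_comm h

lemma twist_twist (z w z' w' : ℤ) (γ : Module.Dual K ↥D.H0) :
    D.twist z w (D.twist z' w' γ) = D.twist (z + z') (w + w') γ := by
  ext h
  simp only [twist_apply, ← LinearEquiv.mul_apply]
  have hc : Commute (D.psiH0 ^ w') (D.phiH0 ^ z) :=
    (D.commute_phiH0_psiH0.symm).zpow_zpow _ _
  congr 2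
  rw [add_comm z, add_comm w, zpow_add, zpow_add, mul_assoc, ← mul_assoc (D.psiH0 ^ w'),
    hc.eq]
  simp only [mul_assoc]

@[simp] lemma twist_zero_zero (γ : Module.Dual K ↥D.H0) : D.twist 0 0 γ = γ := by
  ext h
  simp [twist_apply]

lemma twist_add (z w : ℤ) (γ δ : Module.Dual K ↥D.H0) :
    D.twist z w (γ + δ) = D.twist z w γ + D.twist z w δ := rfl

lemma twist_neg (z w : ℤ) (γ : Module.Dual K ↥D.H0) :
    D.twist z w (-γ) = -D.twist z w γ := rfl

lemma twist_sub (z w : ℤ) (γ δ : Module.Dual K ↥D.H0) :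
    D.twist z w (γ - δ) = D.twist z w γ - D.twist z w δ := rfl

lemma twist_smul (z w : ℤ) (c : K) (γ : Module.Dual K ↥D.H0) :
    D.twist z w (c • γ) = c • D.twist z w γ := rfl

lemma twist_zero (z w : ℤ) : D.twist z w 0 = 0 := rfl

lemma twist_sum {ι : Type*} (z w : ℤ) (s : Finset ι) (f : ι → Module.Dual K ↥D.H0) :
    D.twist z w (∑ i ∈ s, f i) = ∑ i ∈ s, D.twist z w (f i) := by
  ext h
  simp [twist_apply, LinearMap.sum_apply]

lemma twist_phiH0 (γ : Module.Dual K ↥D.H0) (h : ↥D.H0) :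
    D.twist (-1) 0 γ (D.phiH0 h) = γ h := by
  rw [twist_apply, zpow_zero, mul_one, zpow_neg_one, ← LinearEquiv.mul_apply, inv_mul_cancel]
  rfl

lemma twist_psiH0 (γ : Module.Dual K ↥D.H0) (h : ↥D.H0) :
    D.twist 0 (-1) γ (D.psiH0 h) = γ h := by
  rw [twist_apply, zpow_zero, one_mul, zpow_neg_one, ← LinearEquiv.mul_apply, inv_mul_cancel]
  rfl

lemma neg_one_smul_dual (γ : Module.Dual K ↥D.H0) : (-1 : K) • γ = -γ := by
  ext h
  simp

/-! ### Root spaces and twists -/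

lemma mem_rootSpace {γ : Module.Dual K ↥D.H0} {v : A} :
    v ∈ D.rootSpace γ ↔ ∀ h : ↥D.H0, D.br (h : A) (D.phi v) = γ h • D.phi (D.psi v) :=
  Iff.rfl

lemma phi_mem_rootSpace {γ : Module.Dual K ↥D.H0} {v : A} :
    D.phi v ∈ D.rootSpace (D.twist (-1) 0 γ) ↔ v ∈ D.rootSpace γ := by
  simp only [mem_rootSpace]
  rw [D.phiH0.surjective.forall]
  refine forall_congr' fun h => ?_
  rw [twist_phiH0, coe_phiH0, ← D.phi_br, ← D.phi_psi_comm, ← map_smul]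
  exact D.phi.injective.eq_iff

lemma psi_mem_rootSpace {γ : Module.Dual K ↥D.H0} {v : A} :
    D.psi v ∈ D.rootSpace (D.twist 0 (-1) γ) ↔ v ∈ D.rootSpace γ := by
  simp only [mem_rootSpace]
  rw [D.psiH0.surjective.forall]
  refine forall_congr' fun h => ?_
  rw [twist_psiH0, coe_psiH0, D.phi_psi_comm, ← D.psi_br, D.phi_psi_comm (D.psi v), ← map_smul,
    D.psi.injective.eq_iff, D.phi_psi_comm]

lemma map_phi_rootSpace (γ : Module.Dual K ↥D.H0) :
    (D.rootSpace γ).map (D.phi : A →ₗ[K] A) = D.rootSpace (D.twist (-1) 0 γ) := by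
  ext v
  obtain ⟨u, rfl⟩ := D.phi.surjective v
  rw [phi_mem_rootSpace]
  refine ⟨?_, fun hu => Submodule.mem_map_of_mem hu⟩
  rintro ⟨w, hw, hwu⟩
  rwa [← D.phi.injective hwu]

lemma map_psi_rootSpace (γ : Module.Dual K ↥D.H0) :
    (D.rootSpace γ).map (D.psi : A →ₗ[K] A) = D.rootSpace (D.twist 0 (-1) γ) := by
  ext v
  obtain ⟨u, rfl⟩ := D.psi.surjective v
  rw [psi_mem_rootSpace]
  refine ⟨?_, fun hu => Submodule.mem_map_of_mem hu⟩
  rintro ⟨w, hw, hwu⟩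
  rwa [← D.psi.injective hwu]

lemma twist_eq_zero_iff {z w : ℤ} {γ : Module.Dual K ↥D.H0} : D.twist z w γ = 0 ↔ γ = 0 := by
  refine ⟨fun h => ?_, fun h => h ▸ D.twist_zero z w⟩
  have := congrArg (D.twist (-z) (-w)) h
  simpa [twist_twist, twist_zero] using this

lemma twist_phi_mem_roots {γ : Module.Dual K ↥D.H0} :
    D.twist (-1) 0 γ ∈ D.roots ↔ γ ∈ D.roots := by
  simp only [roots, Set.mem_ofPred_eq, ne_eq, twist_eq_zero_iff, ← map_phi_rootSpace]
  rw [(Submodule.map_injective_of_injective D.phi.injective).eq_iff' (Submodule.map_bot _)]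

lemma twist_psi_mem_roots {γ : Module.Dual K ↥D.H0} :
    D.twist 0 (-1) γ ∈ D.roots ↔ γ ∈ D.roots := by
  simp only [roots, Set.mem_ofPred_eq, ne_eq, twist_eq_zero_iff, ← map_psi_rootSpace]
  rw [(Submodule.map_injective_of_injective D.psi.injective).eq_iff' (Submodule.map_bot _)]

lemma twist_mem_roots {z w : ℤ} {γ : Module.Dual K ↥D.H0} :
    D.twist z w γ ∈ D.roots ↔ γ ∈ D.roots := by
  have hz : ∀ (z : ℤ) (γ : Module.Dual K ↥D.H0), D.twist z 0 γ ∈ D.roots ↔ γ ∈ D.roots := by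
    intro z
    induction z using Int.induction_on with
    | zero => simp
    | succ n ih =>
      intro γ
      rw [← ih γ, ← twist_phi_mem_roots, twist_twist]
      simp
    | pred n ih =>
      intro γ
      rw [← ih γ, ← D.twist_phi_mem_roots (γ := D.twist (-(n : ℤ)) 0 γ), twist_twist]
      simp [sub_eq_add_neg, add_comm]
  have hw : ∀ (w : ℤ) (γ : Module.Dual K ↥D.H0), D.twist 0 w γ ∈ D.roots ↔ γ ∈ D.roots := by
    intro w
    induction w using Int.induction_on with
    | zero => simp
    | succ n ih =>
      intro γ
      rw [← ih γ, ← twist_psi_mem_roots, twist_twist]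
      simp
    | pred n ih =>
      intro γ
      rw [← ih γ, ← D.twist_psi_mem_roots (γ := D.twist 0 (-(n : ℤ)) γ), twist_twist]
      simp [sub_eq_add_neg, add_comm]
  have : D.twist z w γ = D.twist z 0 (D.twist 0 w γ) := by simp [twist_twist]
  rw [this, hz, hw]

lemma mem_pm {S : Set (Module.Dual K ↥D.H0)} {γ : Module.Dual K ↥D.H0} :
    γ ∈ D.pm S ↔ γ ∈ S ∨ -γ ∈ S := by
  simp [pm]

lemma neg_mem_pm {S : Set (Module.Dual K ↥D.H0)} {γ : Module.Dual K ↥D.H0} :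
    -γ ∈ D.pm S ↔ γ ∈ D.pm S := by
  simp [mem_pm, or_comm]

lemma sign_smul_mem_pm {S : Set (Module.Dual K ↥D.H0)} {ε : K} (hε : ε = 1 ∨ ε = -1)
    {γ : Module.Dual K ↥D.H0} : ε • γ ∈ D.pm S ↔ γ ∈ D.pm S := by
  rcases hε with rfl | rfl
  · rw [one_smul]
  · rw [neg_one_smul_dual, neg_mem_pm]

lemma twist_mem_pm {z w : ℤ} {γ : Module.Dual K ↥D.H0} :
    D.twist z w γ ∈ D.pm D.roots ↔ γ ∈ D.pm D.roots := by
  simp only [mem_pm, ← twist_neg, twist_mem_roots]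

/-! ### Connectedness is an equivalence relation -/

lemma chainSum_zero (a : ℕ → Module.Dual K ↥D.H0) : D.chainSum a 0 = a 1 := by
  simp [chainSum]

lemma chainSum_succ (a : ℕ → Module.Dual K ↥D.H0) (i : ℕ) :
    D.chainSum a (i + 1) = D.twist (-1) 0 (D.chainSum a i) + D.twist 0 (-1) (a (i + 2)) := by
  unfold chainSum
  rw [Finset.sum_Icc_succ_top (by omega), twist_add, twist_sum, twist_twist, ← add_assoc]
  congr 1
  · congr 1
    · congr 1
      push_cast
      ring
    · refine Finset.sum_congr rfl fun t _ => ?_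
      rw [twist_twist]
      congr 1
      push_cast
      ring
  · congr 1
    push_cast
    ring

lemma chainSum_congr {a b : ℕ → Module.Dual K ↥D.H0} {i : ℕ}
    (h : ∀ t, 1 ≤ t → t ≤ i + 1 → a t = b t) : D.chainSum a i = D.chainSum b i := by
  unfold chainSum
  rw [h 1 le_rfl (by omega)]
  congr 1
  refine Finset.sum_congr rfl fun t ht => ?_
  rw [Finset.mem_Icc] at ht
  rw [h t (by omega) ht.2]

lemma chainSum_twist (z w : ℤ) (a : ℕ → Module.Dual K ↥D.H0) (i : ℕ) :
    D.chainSum (fun t => D.twist z w (a t)) i = D.twist z w (D.chainSum a i) := by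
  simp only [chainSum, twist_add, twist_sum, twist_twist, add_comm]

/-- A form of connectedness which allows arbitrary twists at both ends and chains with a single
element. -/
def Chained (α β : Module.Dual K ↥D.H0) : Prop :=
  ∃ (m : ℕ) (a : ℕ → Module.Dual K ↥D.H0),
    (∀ t, 1 ≤ t → t ≤ m + 1 → a t ∈ D.pm D.roots) ∧
    (∃ z w : ℤ, a 1 = D.twist z w α) ∧
    (∀ i, i ≤ m → D.chainSum a i ∈ D.pm D.roots) ∧
    (∃ z w : ℤ, ∃ ε : K, (ε = 1 ∨ ε = -1) ∧ D.chainSum a m = ε • D.twist z w β)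

variable {D}

lemma Chained.refl {α : Module.Dual K ↥D.H0} (hα : α ∈ D.pm D.roots) : D.Chained α α := by
  refine ⟨0, fun _ => α, fun _ _ _ => hα, ⟨0, 0, by simp⟩, ?_, 0, 0, 1, Or.inl rfl, ?_⟩
  · intro i hi
    obtain rfl : i = 0 := by omega
    rwa [chainSum_zero]
  · simp [chainSum_zero]

lemma sign_mul {ε δ : K} (hε : ε = 1 ∨ ε = -1) (hδ : δ = 1 ∨ δ = -1) :
    ε * δ = 1 ∨ ε * δ = -1 := by
  rcases hε with rfl | rfl <;> rcases hδ with rfl | rfl <;> simp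

lemma sign_mul_self {ε : K} (hε : ε = 1 ∨ ε = -1) : ε * ε = 1 := by
  rcases hε with rfl | rfl <;> simp

lemma Chained.sign_twist {α β : Module.Dual K ↥D.H0} (h : D.Chained α β) {ε : K}
    (hε : ε = 1 ∨ ε = -1) (z w : ℤ) : D.Chained α (ε • D.twist z w β) := by
  obtain ⟨m, a, h1, h2, h3, z', w', δ, hδ, h4⟩ := h
  refine ⟨m, a, h1, h2, h3, z' - z, w' - w, δ * ε, sign_mul hδ hε, ?_⟩
  rw [h4, twist_smul, twist_twist, smul_smul, mul_assoc, sign_mul_self hε]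
  simp

lemma Chained.of_sign_twist {α β : Module.Dual K ↥D.H0} {ε : K} (hε : ε = 1 ∨ ε = -1)
    {z w : ℤ} (h : D.Chained α (ε • D.twist z w β)) : D.Chained α β := by
  have := h.sign_twist hε (-z) (-w)
  rwa [twist_smul, twist_twist, smul_smul, sign_mul_self hε, neg_add_cancel, neg_add_cancel,
    one_smul, twist_zero_zero] at this

lemma Chained.twist {α β : Module.Dual K ↥D.H0} (h : D.Chained α β) (z w : ℤ) :
    D.Chained α (D.twist z w β) := by
  simpa using h.sign_twist (Or.inl rfl) z w

lemma Chained.step {α β γ : Module.Dual K ↥D.H0} (h : D.Chained α β) (hγ : γ ∈ D.pm D.roots)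
    {z w : ℤ} (hs : γ - D.twist z w β ∈ D.pm D.roots) : D.Chained α γ := by
  obtain ⟨m, a, h1, ⟨x, y, h2⟩, h3, z', w', δ, hδ, h4⟩ := h
  set p : Module.Dual K ↥D.H0 :=
    δ • D.twist (z' - 1 - z) (w' - w + 1) (γ - D.twist z w β) with hp
  have hpm : p ∈ D.pm D.roots := by rwa [hp, sign_smul_mem_pm D hδ, twist_mem_pm]
  have hcong : ∀ i, i ≤ m → D.chainSum (Function.update a (m + 2) p) i = D.chainSum a i := by
    intro i hi
    refine D.chainSum_congr fun t _ ht => Function.update_of_ne (by omega) _ _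
  have hlast : D.chainSum (Function.update a (m + 2) p) (m + 1)
      = δ • D.twist (z' - 1 - z) (w' - w) γ := by
    rw [chainSum_succ, hcong m le_rfl, h4, Function.update_self, hp, twist_smul, twist_smul,
      twist_twist, twist_twist, twist_sub, twist_twist, ← smul_add]
    congr 1
    have e1 : -1 + z' = 0 + (z' - 1 - z) + z := by ring
    have e2 : 0 + w' = -1 + (w' - w + 1) + w := by ring
    have e3 : -1 + (w' - w + 1) = w' - w := by ring
    rw [e1, e2, e3, zero_add]
    abel
  refine ⟨m + 1, Function.update a (m + 2) p, ?_, ⟨x, y, ?_⟩, ?_, _, _, δ, hδ, hlast⟩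
  · intro t ht ht'
    rcases eq_or_ne t (m + 2) with rfl | hne
    · rwa [Function.update_self]
    · rw [Function.update_of_ne hne]
      exact h1 t ht (by omega)
  · rw [Function.update_of_ne (by omega), h2]
  · intro i hi
    rcases Nat.lt_or_ge m i with hlt | hle
    · obtain rfl : i = m + 1 := by omega
      rwa [hlast, sign_smul_mem_pm D hδ, twist_mem_pm]
    · rw [hcong i hle]
      exact h3 i hle

lemma Chained.trans {α β γ : Module.Dual K ↥D.H0} (h : D.Chained α β) (h' : D.Chained β γ) :
    D.Chained α γ := by
  obtain ⟨m, a, h1, ⟨x, y, h2⟩, h3, z, w, δ, hδ, h4⟩ := h'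
  have key : ∀ i, i ≤ m → D.Chained α (D.chainSum a i) := by
    intro i
    induction i with
    | zero =>
      intro _
      rw [chainSum_zero, h2]
      exact h.twist x y
    | succ i ih =>
      intro hi
      refine (ih (by omega)).step (h3 _ hi) (z := -1) (w := 0) ?_
      rw [chainSum_succ, add_sub_cancel_left, twist_mem_pm]
      exact h1 _ (by omega) (by omega)
  exact Chained.of_sign_twist hδ (h4 ▸ key m le_rfl)

lemma Chained.symm {α β : Module.Dual K ↥D.H0} (h : D.Chained α β) (hβ : β ∈ D.pm D.roots) :
    D.Chained β α := by
  obtain ⟨m, a, h1, ⟨x, y, h2⟩, h3, z, w, δ, hδ, h4⟩ := h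
  have key : ∀ j, j ≤ m → D.Chained β (D.chainSum a (m - j)) := by
    intro j
    induction j with
    | zero =>
      intro _
      rw [Nat.sub_zero, h4]
      exact (Chained.refl hβ).sign_twist hδ z w
    | succ j ih =>
      intro hj
      refine (ih (by omega)).step (h3 _ (by omega)) (z := 1) (w := 0) ?_
      obtain ⟨i, hi⟩ : ∃ i, m - j = i + 1 := ⟨m - j - 1, by omega⟩
      rw [show m - (j + 1) = i by omega, hi, chainSum_succ, twist_add, twist_twist]
      simp only [Int.reduceNeg, add_neg_cancel, add_zero, twist_zero_zero]
      rw [sub_add_cancel_left, neg_mem_pm, twist_mem_pm, twist_mem_pm]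
      exact h1 _ (by omega) (by omega)
  have h0 := key m le_rfl
  rw [Nat.sub_self, chainSum_zero, h2] at h0
  exact Chained.of_sign_twist (Or.inl rfl) (by rwa [one_smul])

lemma connected_iff_chained {α β : Module.Dual K ↥D.H0} (hα : α ∈ D.roots) (hβ : β ∈ D.roots) :
    D.Connected α β ↔ D.Chained α β := by
  have hα' : α ∈ D.pm D.roots := Or.inl hα
  have hβ' : β ∈ D.pm D.roots := Or.inl hβ
  constructor
  · rintro (⟨z, w, ε, hε, rfl⟩ | ⟨k, a, hk, h1, ⟨n, r, h2⟩, h3, ⟨p, s, h4⟩⟩)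
    · exact (Chained.refl hα').sign_twist hε z w
    · obtain ⟨m, rfl⟩ : ∃ m, k = m + 1 := ⟨k - 1, by omega⟩
      rw [Nat.add_sub_cancel] at h4
      obtain ⟨ε, hε, h4⟩ : ∃ ε : K, (ε = 1 ∨ ε = -1) ∧
          D.chainSum a m = ε • D.twist (-(p : ℤ)) (-(s : ℤ)) β := by
        rcases h4 with h4 | h4
        · exact ⟨1, Or.inl rfl, by simpa using h4⟩
        · exact ⟨-1, Or.inr rfl, by rw [neg_one_smul_dual, h4]⟩
      refine ⟨m, a, h1, ⟨_, _, h2⟩, ?_, _, _, ε, hε, h4⟩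
      intro i hi
      rcases Nat.eq_zero_or_pos i with rfl | hpos
      · rw [chainSum_zero]
        exact h1 1 le_rfl (by omega)
      · rcases hi.eq_or_lt with rfl | hlt
        · rwa [h4, sign_smul_mem_pm D hε, twist_mem_pm]
        · exact h3 i hpos (by omega)
  · rintro ⟨m, a, h1, ⟨z, w, h2⟩, h3, z', w', ε, hε, h4⟩
    rcases Nat.eq_zero_or_pos m with rfl | hm
    · left
      refine ⟨-z' + z, -w' + w, ε, hε, ?_⟩
      rw [chainSum_zero, h2] at h4
      rw [← twist_twist, h4, twist_smul, smul_smul, sign_mul_self hε, twist_twist]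
      simp
    · right
      obtain ⟨N, hN, hN'⟩ : ∃ N : ℤ, z ≤ N ∧ z' ≤ N := ⟨max z z', le_max_left .., le_max_right ..⟩
      obtain ⟨M, hM, hM'⟩ : ∃ M : ℤ, w ≤ M ∧ w' ≤ M := ⟨max w w', le_max_left .., le_max_right ..⟩
      have cast : ∀ {x y : ℤ}, x ≤ y → -((y - x).toNat : ℤ) = -y + x := by
        intro x y hxy
        rw [Int.toNat_of_nonneg (by omega)]
        ring
      refine ⟨m + 1, fun t => D.twist (-N) (-M) (a t), by omega, ?_,
        ⟨(N - z).toNat, (M - w).toNat, ?_⟩, ?_, (N - z').toNat, (M - w').toNat, ?_⟩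
      · intro t ht ht'
        exact D.twist_mem_pm.2 (h1 t ht ht')
      · dsimp only
        rw [h2, twist_twist, cast hN, cast hM]
      · intro i hi hi'
        rw [chainSum_twist, twist_mem_pm]
        exact h3 i (by omega)
      · rw [chainSum_twist, Nat.add_sub_cancel, h4, twist_smul, twist_twist, cast hN', cast hM']
        rcases hε with rfl | rfl
        · exact Or.inl (one_smul _ _)
        · exact Or.inr (neg_one_smul_dual _ _)

lemma classSet_eq_of_chained {α β : Module.Dual K ↥D.H0} (hα : α ∈ D.roots) (hβ : β ∈ D.roots)
    (h : D.Chained α β) : D.classSet α = D.classSet β := by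
  ext γ
  refine and_congr_right fun hγ => ?_
  rw [connected_iff_chained hα hγ, connected_iff_chained hβ hγ]
  exact ⟨(h.symm (Or.inl hβ)).trans, h.trans⟩

lemma mem_classSet_iff {α γ : Module.Dual K ↥D.H0} (hα : α ∈ D.roots) :
    γ ∈ D.classSet α ↔ γ ∈ D.roots ∧ D.Chained α γ :=
  and_congr_right fun hγ => connected_iff_chained hα hγ

lemma twist_mem_classSet {α γ : Module.Dual K ↥D.H0} (hα : α ∈ D.roots) {z w : ℤ} :
    D.twist z w γ ∈ D.classSet α ↔ γ ∈ D.classSet α := by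
  rw [mem_classSet_iff hα, mem_classSet_iff hα, twist_mem_roots]
  refine and_congr_right fun _ => ⟨fun h => ?_, fun h => h.twist z w⟩
  exact Chained.of_sign_twist (Or.inl rfl) (by rwa [one_smul])

/-! ### Graded subspaces stable under the structure maps -/

variable (D)

/-- A graded submodule mapped onto itself by both structure maps. -/
structure IsStable (X : Submodule K A) : Prop where
  graded : X ≤ (X ⊓ D.grade 0) ⊔ (X ⊓ D.grade 1)
  map_phi : X.map (D.phi : A →ₗ[K] A) = X
  map_psi : X.map (D.psi : A →ₗ[K] A) = X

variable {D}

lemma le_of_homogeneous {X S : Submodule K A} (hX : X ≤ (X ⊓ D.grade 0) ⊔ (X ⊓ D.grade 1))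
    (h : ∀ i, ∀ x ∈ X, x ∈ D.grade i → x ∈ S) : X ≤ S :=
  hX.trans (sup_le (fun x hx => h 0 x hx.1 hx.2) (fun x hx => h 1 x hx.1 hx.2))

lemma mem_sup_of_homogeneous {X : Submodule K A} (i : ZMod 2) {x : A} (hx : x ∈ X)
    (hi : x ∈ D.grade i) : x ∈ (X ⊓ D.grade 0) ⊔ (X ⊓ D.grade 1) := by
  fin_cases i
  · exact Submodule.mem_sup_left ⟨hx, hi⟩
  · exact Submodule.mem_sup_right ⟨hx, hi⟩

lemma map₂_le_of_homogeneous {X Y : Submodule K A} (f : A →ₗ[K] A →ₗ[K] A)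
    (hX : X ≤ (X ⊓ D.grade 0) ⊔ (X ⊓ D.grade 1)) (hY : Y ≤ (Y ⊓ D.grade 0) ⊔ (Y ⊓ D.grade 1))
    {S : Submodule K A}
    (h : ∀ i j, ∀ x ∈ X, x ∈ D.grade i → ∀ y ∈ Y, y ∈ D.grade j → f x y ∈ S) :
    Submodule.map₂ f X Y ≤ S := by
  rw [Submodule.map₂_le]
  intro x hx y hy
  have h1 : ∀ j, ∀ y ∈ Y, y ∈ D.grade j → ∀ x ∈ X, f x y ∈ S := by
    intro j y hy hj x hx
    exact le_of_homogeneous (S := S.comap (f.flip y)) hX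
      (fun i x hx hi => h i j x hx hi y hy hj) hx
  exact le_of_homogeneous (S := S.comap (f x)) hY (fun j y hy hj => h1 j y hy hj x hx) hy

lemma graded_map₂ {X Y : Submodule K A} {f : A →ₗ[K] A →ₗ[K] A}
    (hf : ∀ (i j : ZMod 2), ∀ x ∈ D.grade i, ∀ y ∈ D.grade j, f x y ∈ D.grade (i + j))
    (hX : X ≤ (X ⊓ D.grade 0) ⊔ (X ⊓ D.grade 1)) (hY : Y ≤ (Y ⊓ D.grade 0) ⊔ (Y ⊓ D.grade 1)) :
    Submodule.map₂ f X Y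
      ≤ (Submodule.map₂ f X Y ⊓ D.grade 0) ⊔ (Submodule.map₂ f X Y ⊓ D.grade 1) :=
  map₂_le_of_homogeneous f hX hY fun i j x hx hi y hy hj =>
    mem_sup_of_homogeneous (i + j) (Submodule.apply_mem_map₂ f hx hy) (hf i j x hi y hj)

lemma map_map₂_eq {X Y : Submodule K A} {f : A →ₗ[K] A →ₗ[K] A} {e : A →ₗ[K] A}
    (he : ∀ x y, e (f x y) = f (e x) (e y)) (hX : X.map e = X) (hY : Y.map e = Y) :
    (Submodule.map₂ f X Y).map e = Submodule.map₂ f X Y := by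
  refine le_antisymm ?_ ?_
  · rw [Submodule.map_le_iff_le_comap, Submodule.map₂_le]
    intro x hx y hy
    rw [Submodule.mem_comap, he]
    exact Submodule.apply_mem_map₂ f (hX ▸ Submodule.mem_map_of_mem hx)
      (hY ▸ Submodule.mem_map_of_mem hy)
  · rw [Submodule.map₂_le]
    intro x hx y hy
    rw [← hX] at hx
    rw [← hY] at hy
    obtain ⟨x, hx, rfl⟩ := hx
    obtain ⟨y, hy, rfl⟩ := hy
    rw [← he]
    exact Submodule.mem_map_of_mem (Submodule.apply_mem_map₂ f hx hy)

lemma IsStable.sup {X Y : Submodule K A} (hX : D.IsStable X) (hY : D.IsStable Y) :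
    D.IsStable (X ⊔ Y) where
  graded := by
    refine sup_le (hX.graded.trans ?_) (hY.graded.trans ?_)
    · gcongr <;> exact le_sup_left
    · gcongr <;> exact le_sup_right
  map_phi := by rw [Submodule.map_sup, hX.map_phi, hY.map_phi]
  map_psi := by rw [Submodule.map_sup, hX.map_psi, hY.map_psi]

lemma IsStable.map₂_br {X Y : Submodule K A} (hX : D.IsStable X) (hY : D.IsStable Y) :
    D.IsStable (Submodule.map₂ D.br X Y) where
  graded := graded_map₂ D.br_grade hX.graded hY.graded
  map_phi := map_map₂_eq D.phi_br hX.map_phi hY.map_phi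
  map_psi := map_map₂_eq D.psi_br hX.map_psi hY.map_psi

lemma IsStable.map₂_mu {X Y : Submodule K A} (hX : D.IsStable X) (hY : D.IsStable Y) :
    D.IsStable (Submodule.map₂ D.mu X Y) where
  graded := graded_map₂ D.mu_grade hX.graded hY.graded
  map_phi := map_map₂_eq D.phi_mu hX.map_phi hY.map_phi
  map_psi := map_map₂_eq D.psi_mu hX.map_psi hY.map_psi

lemma mem_iff_of_map_eq {X : Submodule K A} {e : A ≃ₗ[K] A} (h : X.map (e : A →ₗ[K] A) = X)
    {x : A} : e x ∈ X ↔ x ∈ X := by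
  refine ⟨fun hx => ?_, fun hx => h ▸ Submodule.mem_map_of_mem hx⟩
  rw [← h] at hx
  obtain ⟨y, hy, hyx⟩ := hx
  rwa [← e.injective hyx]

lemma phi_mem_grade {i : ZMod 2} {x : A} : D.phi x ∈ D.grade i ↔ x ∈ D.grade i :=
  mem_iff_of_map_eq (D.phi_grade i)

lemma psi_mem_grade {i : ZMod 2} {x : A} : D.psi x ∈ D.grade i ↔ x ∈ D.grade i :=
  mem_iff_of_map_eq (D.psi_grade i)

lemma IsStable.phi_mem {X : Submodule K A} (hX : D.IsStable X) {x : A} : D.phi x ∈ X ↔ x ∈ X :=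
  mem_iff_of_map_eq hX.map_phi

lemma IsStable.psi_mem {X : Submodule K A} (hX : D.IsStable X) {x : A} : D.psi x ∈ X ↔ x ∈ X :=
  mem_iff_of_map_eq hX.map_psi

/-! ### Mutually annihilating subspaces -/

variable (D)

/-- All brackets and products between the two submodules vanish. -/
structure Annihilates (X Z : Submodule K A) : Prop where
  br_eq : ∀ x ∈ X, ∀ z ∈ Z, D.br x z = 0
  br_eq' : ∀ x ∈ X, ∀ z ∈ Z, D.br z x = 0
  mu_eq : ∀ x ∈ X, ∀ z ∈ Z, D.mu x z = 0
  mu_eq' : ∀ x ∈ X, ∀ z ∈ Z, D.mu z x = 0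

variable {D}

lemma Annihilates.symm {X Z : Submodule K A} (h : D.Annihilates X Z) : D.Annihilates Z X :=
  ⟨fun z hz x hx => h.br_eq' x hx z hz, fun z hz x hx => h.br_eq x hx z hz,
    fun z hz x hx => h.mu_eq' x hx z hz, fun z hz x hx => h.mu_eq x hx z hz⟩

lemma Annihilates.sup_left {X Y Z : Submodule K A} (hX : D.Annihilates X Z)
    (hY : D.Annihilates Y Z) : D.Annihilates (X ⊔ Y) Z := by
  constructor <;> intro x hx z hz <;> obtain ⟨u, hu, v, hv, rfl⟩ := Submodule.mem_sup.1 hx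
  · simp [hX.br_eq u hu z hz, hY.br_eq v hv z hz]
  · simp [hX.br_eq' u hu z hz, hY.br_eq' v hv z hz]
  · simp [hX.mu_eq u hu z hz, hY.mu_eq v hv z hz]
  · simp [hX.mu_eq' u hu z hz, hY.mu_eq' v hv z hz]

lemma br_eq_zero_comm {X Z : Submodule K A} (hX : D.IsStable X) (hZ : D.IsStable Z)
    (h : ∀ x ∈ X, ∀ z ∈ Z, D.br x z = 0) : ∀ x ∈ X, ∀ z ∈ Z, D.br z x = 0 := by
  have : Submodule.map₂ D.br Z X ≤ ⊥ := by
    refine map₂_le_of_homogeneous D.br hZ.graded hX.graded ?_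
    intro i j z hz hi x hx hj
    obtain ⟨z, rfl⟩ := D.psi.surjective z
    obtain ⟨x, rfl⟩ := D.phi.surjective x
    rw [psi_mem_grade] at hi
    rw [phi_mem_grade] at hj
    rw [hZ.psi_mem] at hz
    rw [hX.phi_mem] at hx
    rw [Submodule.mem_bot, D.skew i j z hi x hj,
      h _ (hX.psi_mem.2 hx) _ (hZ.phi_mem.2 hz), smul_zero]
  exact fun x hx z hz => (Submodule.mem_bot K).1 (this (Submodule.apply_mem_map₂ _ hz hx))

lemma sign_smul_eq_zero {n : ℕ} {v : A} : ((-1 : K) ^ n) • v = 0 ↔ v = 0 := by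
  simp

lemma bilin_left_eq_zero {X Y Z : Submodule K A} {f g : A →ₗ[K] A →ₗ[K] A}
    (hX : D.IsStable X) (hY : D.IsStable Y) (hZ : D.IsStable Z)
    (h : ∀ i j k, ∀ x ∈ X, x ∈ D.grade i → ∀ y ∈ Y, y ∈ D.grade j → ∀ z ∈ Z, z ∈ D.grade k →
      g (f x y) z = 0) :
    ∀ v ∈ Submodule.map₂ f X Y, ∀ z ∈ Z, g v z = 0 := by
  intro v hv z hz
  refine (le_of_homogeneous (S := LinearMap.ker (g v)) hZ.graded ?_ hz : _)
  intro k z hz hk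
  exact (map₂_le_of_homogeneous (S := LinearMap.ker (g.flip z)) f hX.graded hY.graded
    (fun i j x hx hi y hy hj => h i j k x hx hi y hy hj z hz hk) hv : _)

/-- Brackets and products of elements of `X` annihilate everything that `X` annihilates. -/
lemma Annihilates.derived {X Z : Submodule K A} (hX : D.IsStable X) (hZ : D.IsStable Z)
    (h : D.Annihilates X Z) :
    D.Annihilates (Submodule.map₂ D.br X X ⊔ Submodule.map₂ D.mu X X) Z := by
  refine Annihilates.sup_left ?_ ?_
  · have hbr : ∀ v ∈ Submodule.map₂ D.br X X, ∀ z ∈ Z, D.br z v = 0 := by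
      refine bilin_left_eq_zero (g := D.br.flip) hX hX hZ ?_
      intro i j k x hx hi y hy hj z hz hk
      obtain ⟨x, rfl⟩ := D.psi.surjective x
      obtain ⟨y, rfl⟩ := D.phi.surjective y
      obtain ⟨z, rfl⟩ := D.psi.surjective z
      obtain ⟨z, rfl⟩ := D.psi.surjective z
      simp only [psi_mem_grade, phi_mem_grade] at hi hj hk
      simp only [hX.psi_mem, hX.phi_mem, hZ.psi_mem] at hx hy hz
      have := D.jacobi i j k x hi y hj z hk
      rw [h.br_eq _ (hX.psi_mem.2 hy) _ (hZ.phi_mem.2 hz),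
        h.br_eq' _ (hX.phi_mem.2 hx) _ (hZ.psi_mem.2 hz), map_zero, map_zero, smul_zero, smul_zero,
        zero_add, zero_add, sign_smul_eq_zero] at this
      exact this
    have hbr' := br_eq_zero_comm hZ (hX.map₂_br hX) fun z hz v hv => hbr v hv z hz
    refine ⟨fun v hv z hz => hbr' z hz v hv, hbr, ?_, ?_⟩
    · refine bilin_left_eq_zero hX hX hZ ?_
      intro i j k x hx hi y hy hj z hz hk
      obtain ⟨y, rfl⟩ := D.psi.surjective y
      obtain ⟨z, rfl⟩ := D.phi.surjective z
      simp only [psi_mem_grade, phi_mem_grade] at hj hk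
      simp only [hX.psi_mem, hZ.phi_mem] at hy hz
      have := D.leibniz k j x z hk y hj
      rw [h.mu_eq _ hx _ hz, h.br_eq' _ (hX.phi_mem.2 hy) _ hz, map_zero, map_zero,
        LinearMap.zero_apply, zero_add, eq_comm, sign_smul_eq_zero] at this
      exact this
    · refine bilin_left_eq_zero (g := D.mu.flip) hX hX hZ ?_
      intro i j k x hx hi y hy hj z hz hk
      obtain ⟨y, rfl⟩ := D.phi.surjective y
      obtain ⟨z, rfl⟩ := D.phi.surjective z
      simp only [phi_mem_grade] at hj hk
      simp only [hX.phi_mem, hZ.phi_mem] at hy hz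
      have := D.leibniz i j z x hi y hj
      rw [h.mu_eq' _ hx _ hz, h.br_eq' _ (hX.psi_mem.2 hy) _ hz, map_zero, map_zero,
        LinearMap.zero_apply, LinearMap.zero_apply, smul_zero, add_zero] at this
      exact this.symm
  · have hbr : ∀ v ∈ Submodule.map₂ D.mu X X, ∀ z ∈ Z, D.br v z = 0 := by
      refine bilin_left_eq_zero hX hX hZ ?_
      intro i j k x hx hi y hy hj z hz hk
      obtain ⟨z, rfl⟩ := D.phi.surjective z
      obtain ⟨z, rfl⟩ := D.psi.surjective z
      simp only [psi_mem_grade, phi_mem_grade] at hk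
      simp only [hZ.psi_mem, hZ.phi_mem] at hz
      rw [D.leibniz j k x y hj z hk, h.br_eq _ hy _ (hZ.phi_mem.2 hz),
        h.br_eq _ hx _ (hZ.psi_mem.2 hz), map_zero, map_zero, LinearMap.zero_apply, smul_zero,
        add_zero]
    refine ⟨hbr, br_eq_zero_comm (hX.map₂_mu hX) hZ hbr, ?_, ?_⟩
    · refine bilin_left_eq_zero hX hX hZ ?_
      intro i j k x hx hi y hy hj z hz hk
      obtain ⟨z, rfl⟩ := D.psi.surjective z
      rw [← D.assoc, h.mu_eq _ hy _ (hZ.psi_mem.1 hz), map_zero]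
    · refine bilin_left_eq_zero (g := D.mu.flip) hX hX hZ ?_
      intro i j k x hx hi y hy hj z hz hk
      obtain ⟨y, rfl⟩ := D.psi.surjective y
      obtain ⟨z, rfl⟩ := D.phi.surjective z
      rw [LinearMap.flip_apply, D.assoc, h.mu_eq' _ hx _ (hZ.phi_mem.1 hz), map_zero,
        LinearMap.zero_apply]

/-! ### Brackets and products of root spaces -/

lemma graded_rootSpace (γ : Module.Dual K ↥D.H0) :
    D.rootSpace γ ≤ (D.rootSpace γ ⊓ D.grade 0) ⊔ (D.rootSpace γ ⊓ D.grade 1) := by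
  have hdisj : Disjoint (D.grade 0) (D.grade 1) :=
    D.gradeInternal.submodule_iSupIndep.pairwiseDisjoint (by decide)
  have htop : D.grade 0 ⊔ D.grade 1 = ⊤ := by
    rw [← D.gradeInternal.submodule_iSup_eq_top]
    refine le_antisymm (sup_le (le_iSup _ _) (le_iSup _ _)) (iSup_le fun i => ?_)
    fin_cases i
    · exact le_sup_left
    · exact le_sup_right
  intro v hv
  obtain ⟨u, hu, w, hw, rfl⟩ := Submodule.mem_sup.1 (htop ▸ Submodule.mem_top : v ∈ _)
  have hgrade : ∀ i, ∀ x ∈ D.grade i, ∀ h : ↥D.H0,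
      D.br (h : A) (D.phi x) - γ h • D.phi (D.psi x) ∈ D.grade i := by
    intro i x hx h
    refine sub_mem ?_ (Submodule.smul_mem _ _ (phi_mem_grade.2 (psi_mem_grade.2 hx)))
    simpa using D.br_grade 0 i h h.2.2 _ (phi_mem_grade.2 hx)
  have hsum : ∀ h : ↥D.H0, (D.br (h : A) (D.phi u) - γ h • D.phi (D.psi u))
      + (D.br (h : A) (D.phi w) - γ h • D.phi (D.psi w)) = 0 := by
    intro h
    have := D.mem_rootSpace.1 hv h
    simp only [map_add, smul_add] at this
    rw [← sub_eq_zero] at this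
    rw [← this]
    abel
  have hu0 : ∀ h : ↥D.H0, D.br (h : A) (D.phi u) - γ h • D.phi (D.psi u) = 0 := by
    intro h
    refine Submodule.disjoint_def.1 hdisj _ (hgrade 0 u hu h) ?_
    rw [eq_neg_of_add_eq_zero_left (hsum h)]
    exact neg_mem (hgrade 1 w hw h)
  refine Submodule.add_mem_sup ⟨fun h => sub_eq_zero.1 (hu0 h), hu⟩
    ⟨fun h => sub_eq_zero.1 ?_, hw⟩
  simpa [hu0 h] using hsum h

lemma skew_even (h : ↥D.H0) {j : ZMod 2} {x : A} (hx : x ∈ D.grade j) :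
    D.br (D.psi x) (D.phi h) = -D.br (D.psi h) (D.phi x) := by
  rw [D.skew j 0 x hx h h.2.2]
  simp

lemma map₂_br_rootSpace_le (γ δ : Module.Dual K ↥D.H0) :
    Submodule.map₂ D.br (D.rootSpace γ) (D.rootSpace δ)
      ≤ D.rootSpace (D.twist (-1) 0 γ + D.twist 0 (-1) δ) := by
  refine map₂_le_of_homogeneous D.br (graded_rootSpace γ) (graded_rootSpace δ) ?_
  intro i j x hx hi y hy hj
  obtain ⟨γ, rfl⟩ : ∃ γ', γ = D.twist 0 (-1) γ' := ⟨D.twist 0 1 γ, by simp [twist_twist]⟩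
  obtain ⟨δ, rfl⟩ : ∃ δ', δ = D.twist (-1) 0 δ' := ⟨D.twist 1 0 δ, by simp [twist_twist]⟩
  obtain ⟨x, rfl⟩ := D.psi.surjective x
  obtain ⟨y, rfl⟩ := D.phi.surjective y
  rw [psi_mem_rootSpace] at hx
  rw [phi_mem_rootSpace] at hy
  rw [psi_mem_grade] at hi
  rw [phi_mem_grade] at hj
  have hsum : D.twist (-1) 0 (D.twist 0 (-1) γ) + D.twist 0 (-1) (D.twist (-1) 0 δ)
      = D.twist (-1) 0 (D.twist 0 (-1) (γ + δ)) := by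
    simp [twist_twist, twist_add]
  obtain ⟨u, hu⟩ := D.phi.surjective (D.br (D.psi x) (D.phi y))
  rw [hsum, ← hu, phi_mem_rootSpace, mem_rootSpace, D.psiH0.surjective.forall,
    D.psiH0.surjective.forall]
  intro h
  have hxr := mem_rootSpace D |>.1 hx (D.psiH0 h)
  have hyr := mem_rootSpace D |>.1 hy (D.psiH0 h)
  have hjac := D.jacobi 0 i j h h.2.2 x hi y hj
  rw [coe_psiH0] at hxr hyr
  rw [skew_even h hj, hxr, hyr, map_neg, map_smul, map_smul,
    D.skew j i (D.psi y) (psi_mem_grade.2 hj) (D.psi x) (psi_mem_grade.2 hi), neg_smul, smul_neg,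
    smul_neg, smul_neg, smul_comm ((-1 : K) ^ (i.val * j.val)),
    smul_smul ((-1 : K) ^ (i.val * j.val)), mul_comm i.val, ← mul_pow] at hjac
  rw [twist_psiH0, D.phi_psi_comm u, hu, D.psi_br, ← D.phi_psi_comm y, coe_psiH0, coe_psiH0,
    LinearMap.add_apply, add_smul]
  simp only [ZMod.val_zero, zero_mul, pow_zero, one_smul, mul_neg, mul_one, neg_neg, one_pow]
    at hjac
  rw [← sub_eq_zero, ← hjac]
  abel

lemma map₂_mu_rootSpace_le (γ δ : Module.Dual K ↥D.H0) :
    Submodule.map₂ D.mu (D.rootSpace γ) (D.rootSpace δ)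
      ≤ D.rootSpace (D.twist (-1) 0 γ + D.twist 0 (-1) δ) := by
  refine map₂_le_of_homogeneous D.mu (graded_rootSpace γ) (graded_rootSpace δ) ?_
  intro i j x hx hi y hy hj
  rw [mem_rootSpace, D.phiH0.surjective.forall, D.psiH0.surjective.forall,
    D.psiH0.surjective.forall]
  intro h
  have hcomm : ∀ k : ↥D.H0, D.phiH0 (D.psiH0 k) = D.psiH0 (D.phiH0 k) :=
    fun k => Subtype.ext (D.phi_psi_comm k)
  have hxr := mem_rootSpace D |>.1 hx (D.psiH0 (D.psiH0 h))
  have hyr := mem_rootSpace D |>.1 hy (D.psiH0 (D.phiH0 h))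
  have hxs := skew_even (D.psiH0 h) hi
  have hys := skew_even (D.phiH0 h) hj
  have hs := skew_even (D.psiH0 (D.phiH0 h)) (D.mu_grade i j x hi y hj)
  have hl := D.leibniz j 0 (D.psi x) (D.psi y) (psi_mem_grade.2 hj) (D.phi h)
    (phi_mem_grade.2 h.2.2)
  simp only [coe_psiH0, coe_phiH0] at hxr hyr hxs hys hs
  rw [← D.phi_psi_comm h, hxs, hys, hxr, hyr, D.phi_psi_comm h, ← D.psi_mu, hs] at hl
  simp only [map_neg, map_smul, LinearMap.neg_apply, LinearMap.smul_apply, ZMod.val_zero, mul_zero,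
    pow_zero, one_smul, ← D.phi_mu, ← D.psi_mu] at hl
  rw [LinearMap.add_apply, twist_phiH0, hcomm, twist_psiH0, hcomm, add_smul]
  simp only [coe_psiH0, coe_phiH0]
  rw [← neg_inj, hl]
  abel

lemma rootSpace_eq_bot_of_not_chained {γ δ : Module.Dual K ↥D.H0} (hγ : γ ∈ D.roots) (hδ : δ ∈ D.roots)
    (h : ¬ D.Chained γ δ) : D.rootSpace (D.twist (-1) 0 γ + D.twist 0 (-1) δ) = ⊥ := by
  by_contra hne
  have hγ' : γ ∈ D.pm D.roots := Or.inl hγ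
  refine h ?_
  by_cases h0 : D.twist (-1) 0 γ + D.twist 0 (-1) δ = 0
  · refine Chained.of_sign_twist (Or.inr rfl) (z := 0) (w := -1) ?_
    rw [neg_one_smul_dual, ← eq_neg_of_add_eq_zero_left h0]
    exact (Chained.refl hγ').twist _ _
  · have h1 : D.Chained γ (D.twist (-1) 0 γ + D.twist 0 (-1) δ) := by
      refine (Chained.refl hγ').step (Or.inl ⟨h0, hne⟩) (z := -1) (w := 0) ?_
      rw [add_sub_cancel_left, twist_mem_pm]
      exact Or.inl hδ
    refine h1.step (Or.inl hδ) (z := 0) (w := 1) ?_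
    rw [twist_add, twist_twist, twist_twist]
    simp only [Int.reduceNeg, add_neg_cancel, add_zero, zero_add, twist_zero_zero]
    rw [sub_add_cancel_right, neg_mem_pm, twist_mem_pm]
    exact hγ'

/-! ### The subspaces attached to a class of connected roots -/

lemma rootSpace_le_VS {α γ : Module.Dual K ↥D.H0} (h : γ ∈ D.classSet α) :
    D.rootSpace γ ≤ D.VS α :=
  le_iSup₂ (f := fun β (_ : β ∈ D.classSet α) => D.rootSpace β) γ h

lemma isStable_VS {α : Module.Dual K ↥D.H0} (hα : α ∈ D.roots) : D.IsStable (D.VS α) where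
  graded := by
    refine iSup₂_le fun β hβ => (graded_rootSpace β).trans ?_
    gcongr <;> exact rootSpace_le_VS hβ
  map_phi := by
    refine le_antisymm ?_ (iSup₂_le fun β hβ => ?_)
    · simp only [VS, Submodule.map_iSup, map_phi_rootSpace]
      exact iSup₂_le fun β hβ => rootSpace_le_VS ((twist_mem_classSet hα).2 hβ)
    · have : D.rootSpace β = (D.rootSpace (D.twist 1 0 β)).map (D.phi : A →ₗ[K] A) := by
        simp [map_phi_rootSpace, twist_twist]
      rw [this]
      exact Submodule.map_mono (rootSpace_le_VS ((twist_mem_classSet hα).2 hβ))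
  map_psi := by
    refine le_antisymm ?_ (iSup₂_le fun β hβ => ?_)
    · simp only [VS, Submodule.map_iSup, map_psi_rootSpace]
      exact iSup₂_le fun β hβ => rootSpace_le_VS ((twist_mem_classSet hα).2 hβ)
    · have : D.rootSpace β = (D.rootSpace (D.twist 0 1 β)).map (D.psi : A →ₗ[K] A) := by
        simp [map_psi_rootSpace, twist_twist]
      rw [this]
      exact Submodule.map_mono (rootSpace_le_VS ((twist_mem_classSet hα).2 hβ))

lemma IH_le {α : Module.Dual K ↥D.H0} (hα : α ∈ D.roots) :
    D.IH α ≤ Submodule.map₂ D.br (D.VS α) (D.VS α) ⊔ Submodule.map₂ D.mu (D.VS α) (D.VS α) := by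
  refine iSup₂_le fun β hβ => ?_
  have h1 : D.rootSpace (D.twist 0 (-1) β) ≤ D.VS α :=
    rootSpace_le_VS ((twist_mem_classSet hα).2 hβ)
  have h2 : D.rootSpace (-(D.twist (-1) 0 β)) ≤ D.VS α := by
    rcases eq_or_ne (D.rootSpace (-(D.twist (-1) 0 β))) ⊥ with h | h
    · rw [h]
      exact bot_le
    · refine rootSpace_le_VS ((mem_classSet_iff hα).2 ⟨⟨?_, h⟩, ?_⟩)
      · rw [neg_ne_zero, ne_eq, twist_eq_zero_iff]
        exact hβ.1.1
      · rw [← neg_one_smul_dual]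
        exact ((mem_classSet_iff hα).1 hβ).2.sign_twist (Or.inr rfl) _ _
  exact sup_le_sup (Submodule.map₂_le_map₂ h1 h2) (Submodule.map₂_le_map₂ h1 h2)

lemma annihilates_VS {α β : Module.Dual K ↥D.H0} (hα : α ∈ D.roots) (hβ : β ∈ D.roots)
    (h : ¬ D.Chained α β) : D.Annihilates (D.VS α) (D.VS β) := by
  have key : ∀ {α β : Module.Dual K ↥D.H0}, α ∈ D.roots → β ∈ D.roots → ¬ D.Chained α β →
      ∀ f : A →ₗ[K] A →ₗ[K] A,
      (∀ γ δ, Submodule.map₂ f (D.rootSpace γ) (D.rootSpace δ)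
        ≤ D.rootSpace (D.twist (-1) 0 γ + D.twist 0 (-1) δ)) →
      ∀ x ∈ D.VS α, ∀ y ∈ D.VS β, f x y = 0 := by
    intro α β hα hβ h f hf x hx y hy
    have hle : Submodule.map₂ f (D.VS α) (D.VS β) ≤ ⊥ := by
      simp only [VS, Submodule.map₂_iSup_left, Submodule.map₂_iSup_right]
      refine iSup₂_le fun δ hδ => iSup₂_le fun γ hγ => (hf _ _).trans (le_of_eq ?_)
      refine rootSpace_eq_bot_of_not_chained hγ.1 hδ.1 fun hc => h ?_
      exact (((mem_classSet_iff hα).1 hγ).2.trans hc).trans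
        (((mem_classSet_iff hβ).1 hδ).2.symm (Or.inl hδ.1))
    exact (Submodule.mem_bot K).1 (hle (Submodule.apply_mem_map₂ f hx hy))
  have h' : ¬ D.Chained β α := fun hc => h (hc.symm (Or.inl hα))
  exact ⟨key hα hβ h D.br map₂_br_rootSpace_le,
    fun x hx z hz => key hβ hα h' D.br map₂_br_rootSpace_le z hz x hx,
    key hα hβ h D.mu map₂_mu_rootSpace_le,
    fun x hx z hz => key hβ hα h' D.mu map₂_mu_rootSpace_le z hz x hx⟩

end BHPS

namespace BHPS

variable {K A : Type*}

/-- if `[α] ≠ [β]` then `[I_{[α]}, I_{[β]}] + I_{[α]}·I_{[β]} = 0`. -/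
theorem Iclass_orthogonal {K A : Type*} [Field K] [AddCommGroup A] [Module K A] (D : BHPS K A)
    (hsplit : D.IsSplit)
    (α β : Module.Dual K ↥D.H0) (hα : α ∈ D.roots) (hβ : β ∈ D.roots)
    (hne : D.classSet α ≠ D.classSet β) :
    Submodule.map₂ D.br (D.Iclass α) (D.Iclass β)
      ⊔ Submodule.map₂ D.mu (D.Iclass α) (D.Iclass β) = ⊥ := by
  have hc : ¬ D.Chained α β := fun h => hne (classSet_eq_of_chained hα hβ h)
  set X := D.VS α
  set Z := D.VS β
  set X' := Submodule.map₂ D.br X X ⊔ Submodule.map₂ D.mu X X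
  set Z' := Submodule.map₂ D.br Z Z ⊔ Submodule.map₂ D.mu Z Z
  have sX : D.IsStable X := isStable_VS hα
  have sZ : D.IsStable Z := isStable_VS hβ
  have sX' : D.IsStable (X' ⊔ X) := ((sX.map₂_br sX).sup (sX.map₂_mu sX)).sup sX
  have hXZ : D.Annihilates X Z := annihilates_VS hα hβ hc
  have hX'Z : D.Annihilates (X' ⊔ X) Z := (hXZ.derived sX sZ).sup_left hXZ
  have hall : D.Annihilates (Z' ⊔ Z) (X' ⊔ X) :=
    (hX'Z.symm.derived sZ sX').sup_left hX'Z.symm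
  have hα' : D.Iclass α ≤ X' ⊔ X := sup_le_sup_right (IH_le hα) _
  have hβ' : D.Iclass β ≤ Z' ⊔ Z := sup_le_sup_right (IH_le hβ) _
  rw [eq_bot_iff, sup_le_iff, Submodule.map₂_le, Submodule.map₂_le]
  exact ⟨fun x hx z hz => (Submodule.mem_bot K).2 (hall.br_eq' z (hβ' hz) x (hα' hx)),
    fun x hx z hz => (Submodule.mem_bot K).2 (hall.mu_eq' z (hβ' hz) x (hα' hx))⟩

end BHPS
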